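/- Let x, y be real numbers with 0 < x < y. Then: (a) for every z ∈ (y,∞) there exists a unique r ∈ (1,∞) such that ∫ (1/s) dξ_{x,y,z}(s) = r/x²; (b) conversely, for every r ∈ (1,∞) there exists a unique z ∈ (y,∞) such that ∫ (1/s) dξ_{x,y,z}(s) = r/x², and this z is determined by z²/x² = φ_u(r) where u = y²/x² and φ_u(r) = (1−2u+ru²)/((r−1)u). -/

import Mathlib

open MeasureTheory

noncomputable def psi0 (x y z : ℝ) : ℝ := -(x^2 * y^2 * (z^2 - y^2) / (y^2 - x^2))

noncomputable def psi1 (x y z : ℝ) : ℝ := y^2 * (z^2 - x^2) / (y^2 - x^2)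

noncomputable def s0 (x y z : ℝ) : ℝ :=
  (psi1 x y z - Real.sqrt ((psi1 x y z)^2 + 4 * psi0 x y z)) / 2

noncomputable def s1 (x y z : ℝ) : ℝ :=
  (psi1 x y z + Real.sqrt ((psi1 x y z)^2 + 4 * psi0 x y z)) / 2

noncomputable def rho (x y z : ℝ) : ℝ := (s1 x y z - x^2) / (s1 x y z - s0 x y z)

/-- The Berger measure associated with the Stampfli completion of `(x,y,z)`. -/
noncomputable def xi (x y z : ℝ) : Measure ℝ :=
  ENNReal.ofReal (rho x y z) • Measure.dirac (s0 x y z) +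
    ENNReal.ofReal (1 - rho x y z) • Measure.dirac (s1 x y z)

lemma psi_discrim_eq {x y : ℝ} (z : ℝ) (hx : 0 < x) (hxy : x < y) :
    (psi1 x y z)^2 + 4 * psi0 x y z = (psi1 x y z - 2 * x^2)^2 + 4 * x^2 * (y^2 - x^2) := by
  have h : y^2 - x^2 ≠ 0 := by nlinarith
  unfold psi1 psi0
  field_simp
  ring

lemma s0_mul_s1 {x y : ℝ} (z : ℝ) (hx : 0 < x) (hxy : x < y) :
    s0 x y z * s1 x y z = -psi0 x y z := by
  have hD : 0 ≤ (psi1 x y z)^2 + 4 * psi0 x y z := by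
    rw [psi_discrim_eq z hx hxy]
    have : 0 < y^2 - x^2 := by nlinarith
    positivity
  have := Real.sq_sqrt hD
  unfold s0 s1
  linear_combination -this / 4

lemma s0_add_s1 (x y z : ℝ) : s0 x y z + s1 x y z = psi1 x y z := by
  unfold s0 s1
  ring

lemma s0_lt_sq_lt_s1 {x y : ℝ} (z : ℝ) (hx : 0 < x) (hxy : x < y) :
    s0 x y z < x^2 ∧ x^2 < s1 x y z := by
  have hlt : |psi1 x y z - 2 * x^2| < √((psi1 x y z)^2 + 4 * psi0 x y z) := by
    rw [psi_discrim_eq z hx hxy, ← Real.sqrt_sq_eq_abs]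
    have : 0 < 4 * x^2 * (y^2 - x^2) := by
      have : 0 < y^2 - x^2 := by nlinarith
      positivity
    exact Real.sqrt_lt_sqrt (sq_nonneg _) (by linarith)
  rw [abs_lt] at hlt
  unfold s0 s1
  constructor <;> linarith [hlt.1, hlt.2]

lemma integral_xi {x y z : ℝ} (h0 : s0 x y z < x^2) (h1 : x^2 < s1 x y z) (f : ℝ → ℝ) :
    ∫ s, f s ∂(xi x y z) = rho x y z * f (s0 x y z) + (1 - rho x y z) * f (s1 x y z) := by
  have hd : 0 < s1 x y z - s0 x y z := by linarith
  have hρ : 0 ≤ rho x y z := div_nonneg (by linarith) hd.le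
  have hρ' : 0 ≤ 1 - rho x y z := by
    rw [sub_nonneg, rho, div_le_one hd]
    linarith
  have hint (c a : ℝ) : Integrable f (ENNReal.ofReal c • Measure.dirac a) :=
    (integrable_dirac (by simp)).smul_measure ENNReal.ofReal_ne_top
  rw [xi, integral_add_measure (hint _ _) (hint _ _), integral_smul_measure,
    integral_smul_measure, integral_dirac, integral_dirac, ENNReal.toReal_ofReal hρ,
    ENNReal.toReal_ofReal hρ', smul_eq_mul, smul_eq_mul]

lemma integral_one_div_xi {x y z : ℝ} (hx : 0 < x) (hxy : x < y) (hyz : y < z) :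
    ∫ s, 1 / s ∂(xi x y z) =
      (y^2 * z^2 - 2 * x^2 * y^2 + x^4) / (y^2 * (z^2 - y^2)) / x^2 := by
  obtain ⟨h0, h1⟩ := s0_lt_sq_lt_s1 z hx hxy
  have hy : 0 < y := hx.trans hxy
  have hyx : 0 < y^2 - x^2 := by nlinarith
  have hzy : 0 < z^2 - y^2 := by nlinarith
  have hprod := s0_mul_s1 z hx hxy
  have hneg : -psi0 x y z = x^2 * y^2 * (z^2 - y^2) / (y^2 - x^2) := neg_neg _
  have hpos : 0 < s0 x y z * s1 x y z := by
    rw [hprod, hneg]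
    positivity
  have hs1 : 0 < s1 x y z := (pow_pos hx 2).trans h1
  have hs0 : 0 < s0 x y z := pos_of_mul_pos_left hpos hs1.le
  have hd : s1 x y z - s0 x y z ≠ 0 := by linarith
  have hI : ∫ s, 1 / s ∂(xi x y z) = (psi1 x y z - x^2) / (-psi0 x y z) := by
    rw [integral_xi h0 h1, ← hprod, ← s0_add_s1, rho]
    field_simp
    ring
  rw [hI, hneg, psi1]
  field_simp
  ring

lemma integral_one_div_xi_eq_iff {x y z r : ℝ} (hx : 0 < x) (hxy : x < y) (hyz : y < z) :
    ∫ s, 1 / s ∂(xi x y z) = r / x^2 ↔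
      z^2 * (y^2 * (r - 1)) = r * y^4 - 2 * x^2 * y^2 + x^4 := by
  have hy : 0 < y := hx.trans hxy
  have hzy : 0 < z^2 - y^2 := by nlinarith
  rw [integral_one_div_xi hx hxy hyz, div_left_inj' (by positivity),
    div_eq_iff (by positivity)]
  constructor <;> intro h <;> linear_combination -h

theorem stmt9 (x y : ℝ) (hx : 0 < x) (hxy : x < y) :
    (∀ z : ℝ, y < z →
      ∃! r : ℝ, 1 < r ∧ ∫ s, 1 / s ∂(xi x y z) = r / x^2) ∧
    (∀ r : ℝ, 1 < r →
      (∃! z : ℝ, y < z ∧ ∫ s, 1 / s ∂(xi x y z) = r / x^2) ∧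
      (∀ z : ℝ, y < z → (∫ s, 1 / s ∂(xi x y z) = r / x^2) →
        z^2 / x^2 =
          (1 - 2*(y^2/x^2) + r*(y^2/x^2)^2) / ((r - 1) * (y^2/x^2)))) := by
  have hy : 0 < y := hx.trans hxy
  have hyx : 0 < y^2 - x^2 := by nlinarith
  have hsq : 0 < (y^2 - x^2)^2 := by positivity
  refine ⟨fun z hz ↦ ?_, fun r hr ↦ ⟨?_, fun z hz h ↦ ?_⟩⟩
  · have hzy : 0 < z^2 - y^2 := by nlinarith
    refine ⟨_, ⟨?_, integral_one_div_xi hx hxy hz⟩, fun r hr ↦ ?_⟩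
    · rw [one_lt_div (by positivity)]
      linarith
    · have h := hr.2
      rw [integral_one_div_xi hx hxy hz, div_left_inj' (by positivity)] at h
      exact h.symm
  · have hr' : 0 < r - 1 := sub_pos.2 hr
    have hc : 0 < y^2 * (r - 1) := by positivity
    have hlt : y^2 < (r * y^4 - 2 * x^2 * y^2 + x^4) / (y^2 * (r - 1)) := by
      rw [lt_div_iff₀ hc]
      linarith
    have hyz := Real.lt_sqrt_of_sq_lt hlt
    refine ⟨_, ⟨hyz, ?_⟩, fun z hz ↦ ?_⟩
    · rw [integral_one_div_xi_eq_iff hx hxy hyz, Real.sq_sqrt ((sq_nonneg y).trans hlt.le),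
        div_mul_cancel₀ _ hc.ne']
    · have h := (integral_one_div_xi_eq_iff hx hxy hz.1).1 hz.2
      rw [← (eq_div_iff hc.ne').2 h, Real.sqrt_sq (hy.trans hz.1).le]
  · have hr' : r - 1 ≠ 0 := (sub_pos.2 hr).ne'
    rw [integral_one_div_xi_eq_iff hx hxy hz] at h
    field_simp
    linear_combination h
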